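/- Let (T¹,T²) ∈ ℝ² with (T¹,T²) ≠ (0,0), and consider on ℝ² the connection with constant Christoffel symbols Γ_{11}¹ = 1, Γ_{12}¹ = T¹, Γ_{12}² = 1 + T², Γ_{21}¹ = −T¹, Γ_{21}² = 1 − T², Γ_{22}¹ = −1, and all other Γ_{ij}^k = 0 (the model M₅⁶(T) with T ≠ 0). Then a smooth vector field X on ℝ² is an affine Killing vector field for this connection if and only if X lies in the ℝ-linear span of the two constant vector fields (1,0) and (0,1). -/

import Mathlib

open Real

/-- The partial derivative `∂f/∂x^i` of a function on `ℝ²` (points are `Fin 2 → ℝ`). -/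
noncomputable def pd (f : (Fin 2 → ℝ) → ℝ) (i : Fin 2) (p : Fin 2 → ℝ) : ℝ :=
  fderiv ℝ f p (Pi.single i 1)

/-- The affine Killing operator
`K^Γ_{ij}^k(v) = ∂_i∂_j v^k + v^l ∂_l Γ_{ij}^k − Γ_{ij}^l ∂_l v^k + Γ_{il}^k ∂_j v^l + Γ_{lj}^k ∂_i v^l`
(summation over `l`). -/
noncomputable def killingOp (Γ : Fin 2 → Fin 2 → Fin 2 → (Fin 2 → ℝ) → ℝ)
    (v : Fin 2 → (Fin 2 → ℝ) → ℝ) (i j k : Fin 2) (p : Fin 2 → ℝ) : ℝ :=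
  pd (fun q => pd (v k) j q) i p
    + (∑ l : Fin 2, v l p * pd (Γ i j k) l p)
    - (∑ l : Fin 2, Γ i j l p * pd (v k) l p)
    + (∑ l : Fin 2, Γ i l k p * pd (v l) j p)
    + (∑ l : Fin 2, Γ l j k p * pd (v l) i p)

/-- `v` is an affine Killing vector field for the connection `Γ` on `U`:
all eight affine Killing equations hold on `U`. -/
def IsAffineKilling (U : Set (Fin 2 → ℝ))
    (Γ : Fin 2 → Fin 2 → Fin 2 → (Fin 2 → ℝ) → ℝ)
    (v : Fin 2 → (Fin 2 → ℝ) → ℝ) : Prop :=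
  ∀ i j k : Fin 2, ∀ p ∈ U, killingOp Γ v i j k p = 0

theorem ContDiff.pd {f : (Fin 2 → ℝ) → ℝ} (hf : ContDiff ℝ (⊤ : ℕ∞) f) (i : Fin 2) :
    ContDiff ℝ (⊤ : ℕ∞) (pd f i) :=
  (hf.fderiv_right (m := (⊤ : ℕ∞)) (by norm_cast)).clm_apply contDiff_const

theorem pd_const (c : ℝ) (i : Fin 2) (p : Fin 2 → ℝ) : pd (fun _ => c) i p = 0 := by
  simp [pd]

theorem pd_const_mul {f : (Fin 2 → ℝ) → ℝ} (hf : Differentiable ℝ f) (c : ℝ) (i : Fin 2)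
    (p : Fin 2 → ℝ) : pd (fun q => c * f q) i p = c * pd f i p := by
  simp [pd, fderiv_const_mul (hf p)]

theorem pd_comm {f : (Fin 2 → ℝ) → ℝ} (hf : ContDiff ℝ (⊤ : ℕ∞) f) (i j : Fin 2)
    (p : Fin 2 → ℝ) : pd (pd f i) j p = pd (pd f j) i p := by
  have hd : DifferentiableAt ℝ (fderiv ℝ f) p :=
    (hf.fderiv_right (m := (⊤ : ℕ∞)) (by norm_cast)).differentiable (by simp) p
  have key : ∀ k l : Fin 2, pd (pd f k) l p =
      fderiv ℝ (fderiv ℝ f) p (Pi.single l 1) (Pi.single k 1) := by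
    intro k l
    change fderiv ℝ (fun q => fderiv ℝ f q (Pi.single k 1)) p (Pi.single l 1) = _
    rw [fderiv_clm_apply hd (differentiableAt_const _)]
    simp
  rw [key, key]
  exact (hf.contDiffAt.isSymmSndFDerivAt (by simp; norm_cast)) _ _

theorem eq_of_pd_eq_zero {f : (Fin 2 → ℝ) → ℝ} (hf : Differentiable ℝ f)
    (h : ∀ i p, pd f i p = 0) (p q : Fin 2 → ℝ) : f p = f q := by
  refine is_const_of_fderiv_eq_zero hf (fun x => ?_) p q
  refine ContinuousLinearMap.coe_injective (LinearMap.pi_ext' fun i => LinearMap.ext_ring ?_)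
  simpa [pd] using h i x

theorem eq_zero_of_rotation_relations {s t x y : ℝ} (hst : (s, t) ≠ (0, 0))
    (h₁ : s * x = t * y) (h₂ : s * y = -(t * x)) : x = 0 ∧ y = 0 := by
  have hpos : s ^ 2 + t ^ 2 ≠ 0 := by
    intro h
    apply hst
    have hs : s = 0 := by nlinarith [sq_nonneg s, sq_nonneg t]
    have ht : t = 0 := by nlinarith [sq_nonneg s, sq_nonneg t]
    rw [hs, ht]
  constructor
  · exact (mul_eq_zero.1 (by linear_combination s * h₁ + t * h₂ :
      (s ^ 2 + t ^ 2) * x = 0)).resolve_left hpos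
  · exact (mul_eq_zero.1 (by linear_combination s * h₂ - t * h₁ :
      (s ^ 2 + t ^ 2) * y = 0)).resolve_left hpos

theorem stmt10 (T1 T2 : ℝ) (hT : (T1, T2) ≠ (0, 0))
    (v : Fin 2 → (Fin 2 → ℝ) → ℝ)
    (hv : ∀ i : Fin 2, ContDiff ℝ (⊤ : ℕ∞) (v i)) :
    IsAffineKilling Set.univ
      (fun i j k => fun _ : Fin 2 → ℝ =>
        ![![![(1 : ℝ), 0], ![T1, 1 + T2]], ![![-T1, 1 - T2], ![-1, 0]]] i j k) v
    ↔ ∃ a b : ℝ, ∀ p : Fin 2 → ℝ, v 0 p = a ∧ v 1 p = b := by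
  constructor
  · intro h
    have hdiff : ∀ k i, Differentiable ℝ (pd (v k) i) := fun k i =>
      ((hv k).pd i).differentiable (by simp)
    have K : ∀ i j k p, _ := fun i j k p => h i j k p (Set.mem_univ p)
    simp only [killingOp, pd_const, Fin.sum_univ_two, mul_zero, add_zero] at K
    have torsion₁ : ∀ p, T1 * pd (v 1) 1 p = T2 * pd (v 0) 1 p := by
      intro p
      have e₁ := K 0 1 0 p
      have e₂ := K 1 0 0 p
      have e₃ := pd_comm (hv 0) 0 1 p
      simp at e₁ e₂
      linear_combination (e₁ - e₂ + e₃) / 2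
    have torsion₂ : ∀ p, T1 * pd (v 1) 0 p = T2 * pd (v 0) 0 p := by
      intro p
      have e₁ := K 0 1 1 p
      have e₂ := K 1 0 1 p
      have e₃ := pd_comm (hv 1) 0 1 p
      simp at e₁ e₂
      linear_combination -(e₁ - e₂ + e₃) / 2
    have torsion_deriv : ∀ i p, T1 * pd (pd (v 1) 1) i p = T2 * pd (pd (v 0) 1) i p := by
      intro i p
      rw [← pd_const_mul (hdiff 1 1), ← pd_const_mul (hdiff 0 1), funext torsion₁]
    have hx : ∀ p, pd (v 1) 0 p = 0 ∧ pd (v 0) 0 p = 0 := by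
      intro p
      have e₁ := K 0 1 0 p
      have e₂ := K 0 1 1 p
      have e₃ := torsion_deriv 0 p
      simp at e₁ e₂
      refine eq_zero_of_rotation_relations hT (torsion₂ p) ?_
      linear_combination -e₃ + T1 * e₂ - T2 * e₁ + T2 * torsion₁ p + T1 * torsion₂ p
    have hy : ∀ p, pd (v 1) 1 p = 0 ∧ pd (v 0) 1 p = 0 := by
      intro p
      have e₁ := K 1 1 0 p
      have e₂ := K 1 1 1 p
      have e₃ := torsion_deriv 1 p
      simp [hx p] at e₁ e₂
      refine eq_zero_of_rotation_relations hT (torsion₁ p) ?_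
      linear_combination (-e₃ + T1 * e₂ - T2 * e₁) / 2
    refine ⟨v 0 0, v 1 0, fun p => ⟨?_, ?_⟩⟩ <;>
      refine eq_of_pd_eq_zero ((hv _).differentiable (by simp)) (fun i q => ?_) p 0 <;>
      fin_cases i
    exacts [(hx q).2, (hy q).2, (hx q).1, (hy q).1]
  · rintro ⟨a, b, hab⟩ i j k p -
    have hpd : ∀ k i, pd (v k) i = fun _ => 0 := by
      intro k i
      have hk : v k = fun _ => v k 0 := by
        funext q
        fin_cases k
        exacts [(hab q).1.trans (hab 0).1.symm, (hab q).2.trans (hab 0).2.symm]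
      funext q
      rw [hk, pd_const]
    simp [killingOp, hpd, pd_const]
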